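/- Let C ⊆ ℝ^d be convex with constrained least-squares solution x_LS, and run the iterative Hessian sketch with sketch matrices S¹,…,S^N. If for each t = 0,…,N−1 one has A(x_LS − x^t) ≠ 0 and Z₁^{t+1} > 0, then the final iterate x^N satisfies ‖x^N − x_LS‖_A ≤ (∏_{t=1}^{N} Z₂^t/Z₁^t) · ‖x_LS‖_A. -/

import Mathlib

open MeasureTheory Matrix Finset

/-- Squared Euclidean norm of a vector. -/
noncomputable def sqNorm {k : ℕ} (v : Fin k → ℝ) : ℝ := ∑ i, (v i) ^ 2

/-- Euclidean (ℓ₂) norm of a vector. -/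
noncomputable def l2norm {k : ℕ} (v : Fin k → ℝ) : ℝ := Real.sqrt (sqNorm v)

/-- Prediction semi-norm ‖v‖_A = (1/√n)‖A v‖₂. -/
noncomputable def predNorm {n d : ℕ} (A : Matrix (Fin n) (Fin d) ℝ) (v : Fin d → ℝ) : ℝ :=
  l2norm (A.mulVec v) / Real.sqrt n

/-- Transformed tangent cone K_LS = {t · A(x − x_LS) : t ≥ 0, x ∈ C}. -/
def Kcone {n d : ℕ} (A : Matrix (Fin n) (Fin d) ℝ) (C : Set (Fin d → ℝ))
    (xLS : Fin d → ℝ) : Set (Fin n → ℝ) :=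
  {v | ∃ t : ℝ, 0 ≤ t ∧ ∃ x ∈ C, v = t • A.mulVec (x - xLS)}

/-- Z₁(S) = inf over unit-norm vectors of the cone of (1/m)‖S v‖₂². -/
noncomputable def Z1 {n m : ℕ} (S : Matrix (Fin m) (Fin n) ℝ) (K : Set (Fin n → ℝ)) : ℝ :=
  sInf ((fun v => (1 / (m : ℝ)) * sqNorm (S.mulVec v)) '' {v ∈ K | l2norm v = 1})

/-- Z₂(S) = sup over unit-norm vectors of the cone of |⟨u, (SᵀS/m − I) v⟩|. -/
noncomputable def Z2 {n m : ℕ} (S : Matrix (Fin m) (Fin n) ℝ) (K : Set (Fin n → ℝ))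
    (u : Fin n → ℝ) : ℝ :=
  sSup ((fun v => |u ⬝ᵥ (((1 / (m : ℝ)) • (Sᵀ * S) - 1).mulVec v)|) '' {v ∈ K | l2norm v = 1})

theorem sqNorm_eq_dot {k : ℕ} (v : Fin k → ℝ) : sqNorm v = v ⬝ᵥ v := by
  simp [sqNorm, dotProduct, sq]

theorem sqNorm_nn {k : ℕ} (v : Fin k → ℝ) : 0 ≤ sqNorm v :=
  Finset.sum_nonneg fun i _ => sq_nonneg _

theorem l2norm_smul' {k : ℕ} (c : ℝ) (hc : 0 ≤ c) (v : Fin k → ℝ) :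
    l2norm (c • v) = c * l2norm v := by
  have : sqNorm (c • v) = c ^ 2 * sqNorm v := by
    simp [sqNorm, mul_pow, Finset.mul_sum]
  rw [l2norm, this, Real.sqrt_mul (sq_nonneg c), Real.sqrt_sq hc, l2norm]

theorem l2norm_neg' {k : ℕ} (v : Fin k → ℝ) : l2norm (-v) = l2norm v := by
  simp [l2norm, sqNorm]

theorem l2norm_zero_imp {k : ℕ} (v : Fin k → ℝ) (h : l2norm v = 0) : v = 0 := by
  have h1 : sqNorm v = 0 := (Real.sqrt_eq_zero (sqNorm_nn v)).1 h
  rw [sqNorm_eq_dot] at h1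
  exact dotProduct_self_eq_zero.1 h1

theorem sqNorm_add_smul {k : ℕ} (a b : Fin k → ℝ) (s : ℝ) :
    sqNorm (a + s • b) = sqNorm a + 2 * s * (a ⬝ᵥ b) + s ^ 2 * sqNorm b := by
  simp only [sqNorm_eq_dot, add_dotProduct, dotProduct_add, smul_dotProduct, dotProduct_smul,
    smul_eq_mul, dotProduct_comm b a]
  ring

theorem first_order {a b : ℝ} (h : ∀ s : ℝ, 0 < s → s ≤ 1 → 0 ≤ s * b + s ^ 2 * a) : 0 ≤ b := by
  by_contra hb
  push Not at hb
  have hpos : 0 < |a| - b := by linarith [abs_nonneg a]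
  have hs : 0 < -b / (2 * (|a| - b)) := by apply div_pos <;> linarith
  have hs1 : -b / (2 * (|a| - b)) ≤ 1 := by
    rw [div_le_one (by linarith)]; linarith [abs_nonneg a]
  have h1 := h _ hs hs1
  set s := -b / (2 * (|a| - b)) with hsd
  have h2 : s * (2 * (|a| - b)) = -b := by rw [hsd]; field_simp
  have h3 : 0 ≤ b + s * a := by
    by_contra hc
    push Not at hc
    nlinarith
  nlinarith [le_abs_self a]

theorem Z1_le {n m : ℕ} (S : Matrix (Fin m) (Fin n) ℝ) (K : Set (Fin n → ℝ)) (v : Fin n → ℝ)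
    (hv : v ∈ K) (h1 : l2norm v = 1) : Z1 S K ≤ (1 / (m : ℝ)) * sqNorm (S.mulVec v) := by
  apply csInf_le
  · refine ⟨0, ?_⟩
    rintro _ ⟨w, _, rfl⟩
    have := sqNorm_nn (S.mulVec w)
    positivity
  · exact ⟨v, ⟨hv, h1⟩, rfl⟩

theorem le_Z2 {n m : ℕ} (S : Matrix (Fin m) (Fin n) ℝ) (K : Set (Fin n → ℝ)) (u v : Fin n → ℝ)
    (hv : v ∈ K) (h1 : l2norm v = 1) :
    |u ⬝ᵥ (((1 / (m : ℝ)) • (Sᵀ * S) - 1).mulVec v)| ≤ Z2 S K u := by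
  apply le_csSup
  · refine ⟨∑ i, |(u ᵥ* ((1 / (m : ℝ)) • (Sᵀ * S) - 1)) i|, ?_⟩
    rintro _ ⟨w, ⟨_, hw⟩, rfl⟩
    simp only [dotProduct_mulVec]
    refine (Finset.abs_sum_le_sum_abs _ _).trans (Finset.sum_le_sum fun i _ => ?_)
    rw [abs_mul]
    have h2 : sqNorm w = 1 := by
      rw [l2norm, Real.sqrt_eq_one] at hw; exact hw
    have h3 : (w i) ^ 2 ≤ 1 := by
      rw [← h2]
      exact Finset.single_le_sum (f := fun i => (w i) ^ 2) (fun j _ => sq_nonneg _)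
        (Finset.mem_univ i)
    exact mul_le_of_le_one_right (abs_nonneg _) (sq_le_one_iff_abs_le_one _ |>.1 h3)
  · exact ⟨v, ⟨hv, h1⟩, rfl⟩

theorem Z2_nn {n m : ℕ} (S : Matrix (Fin m) (Fin n) ℝ) (K : Set (Fin n → ℝ)) (u : Fin n → ℝ) :
    0 ≤ Z2 S K u := by
  apply Real.sSup_nonneg
  rintro _ ⟨w, _, rfl⟩
  exact abs_nonneg _

theorem key_ineq {n d m : ℕ} (hn : 0 < n) (hm : 0 < m)
    (C : Set (Fin d → ℝ)) (hC : Convex ℝ C)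
    (A : Matrix (Fin n) (Fin d) ℝ) (y : Fin n → ℝ)
    (S : Matrix (Fin m) (Fin n) ℝ)
    (xLS : Fin d → ℝ) (hLSmem : xLS ∈ C)
    (hLSmin : ∀ x ∈ C,
      (1 / (2 * (n : ℝ))) * sqNorm (A.mulVec xLS - y)
        ≤ (1 / (2 * (n : ℝ))) * sqNorm (A.mulVec x - y))
    (x0 x1 : Fin d → ℝ) (hmem : x1 ∈ C)
    (hmin : ∀ z ∈ C,
      (1 / (2 * (m : ℝ))) * sqNorm (S.mulVec (A.mulVec (x1 - x0)))
          - (Aᵀ.mulVec (y - A.mulVec x0)) ⬝ᵥ x1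
        ≤ (1 / (2 * (m : ℝ))) * sqNorm (S.mulVec (A.mulVec (z - x0)))
          - (Aᵀ.mulVec (y - A.mulVec x0)) ⬝ᵥ z) :
    (1 / (m : ℝ)) * sqNorm (S.mulVec (A.mulVec (x1 - xLS))) ≤
      - (A.mulVec (xLS - x0) ⬝ᵥ
        (((1 / (m : ℝ)) • (Sᵀ * S) - 1).mulVec (A.mulVec (x1 - xLS)))) := by
  have hn' : (0 : ℝ) < n := by exact_mod_cast hn
  have hm' : (0 : ℝ) < m := by exact_mod_cast hm
  have opt1 : 0 ≤ (1 / (n : ℝ)) * ((A.mulVec xLS - y) ⬝ᵥ A.mulVec (x1 - xLS)) := by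
    apply first_order (a := (1 / (2 * (n : ℝ))) * sqNorm (A.mulVec (x1 - xLS)))
    intro s hs hs1
    have h := hLSmin (xLS + s • (x1 - xLS)) (hC.add_smul_sub_mem hLSmem hmem ⟨hs.le, hs1⟩)
    have e : A.mulVec (xLS + s • (x1 - xLS)) - y
        = (A.mulVec xLS - y) + s • A.mulVec (x1 - xLS) := by
      rw [mulVec_add, mulVec_smul]; abel
    rw [e, sqNorm_add_smul] at h
    have : s * ((1 / (n : ℝ)) * ((A.mulVec xLS - y) ⬝ᵥ A.mulVec (x1 - xLS)))
        = (1 / (2 * (n : ℝ))) * (2 * s * ((A.mulVec xLS - y) ⬝ᵥ A.mulVec (x1 - xLS))) := by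
      field_simp
    rw [this]
    linarith
  have opt1' : 0 ≤ (A.mulVec xLS - y) ⬝ᵥ A.mulVec (x1 - xLS) :=
    nonneg_of_mul_nonneg_right opt1 (by positivity)
  have opt2 : 0 ≤ (1 / (m : ℝ)) * (S.mulVec (A.mulVec (x1 - x0)) ⬝ᵥ
        S.mulVec (A.mulVec (xLS - x1))) - (y - A.mulVec x0) ⬝ᵥ A.mulVec (xLS - x1) := by
    apply first_order (a := (1 / (2 * (m : ℝ))) * sqNorm (S.mulVec (A.mulVec (xLS - x1))))
    intro s hs hs1
    have h := hmin (x1 + s • (xLS - x1)) (hC.add_smul_sub_mem hmem hLSmem ⟨hs.le, hs1⟩)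
    have e : S.mulVec (A.mulVec (x1 + s • (xLS - x1) - x0))
        = S.mulVec (A.mulVec (x1 - x0)) + s • S.mulVec (A.mulVec (xLS - x1)) := by
      rw [← mulVec_smul, ← mulVec_smul, ← mulVec_add, ← mulVec_add]
      congr 2; abel
    rw [e, sqNorm_add_smul, dotProduct_add, dotProduct_smul, smul_eq_mul] at h
    have e2 : Aᵀ.mulVec (y - A.mulVec x0) ⬝ᵥ (xLS - x1)
        = (y - A.mulVec x0) ⬝ᵥ A.mulVec (xLS - x1) := by
      rw [mulVec_transpose, dotProduct_mulVec]
    rw [e2] at h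
    have : s * ((1 / (m : ℝ)) * (S.mulVec (A.mulVec (x1 - x0)) ⬝ᵥ
        S.mulVec (A.mulVec (xLS - x1)))) = (1 / (2 * (m : ℝ))) *
        (2 * s * (S.mulVec (A.mulVec (x1 - x0)) ⬝ᵥ S.mulVec (A.mulVec (xLS - x1)))) := by
      field_simp
    rw [mul_sub, this]
    linarith
  have e1 : A.mulVec (xLS - x1) = - A.mulVec (x1 - xLS) := by
    rw [← mulVec_neg]; congr 1; abel
  have e2 : A.mulVec (x1 - x0) = A.mulVec (x1 - xLS) + A.mulVec (xLS - x0) := by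
    rw [← mulVec_add]; congr 1; abel
  have e3 : y - A.mulVec x0 = A.mulVec (xLS - x0) - (A.mulVec xLS - y) := by
    rw [mulVec_sub]; abel
  rw [e1, e2, e3] at opt2
  have e4 : A.mulVec (xLS - x0) ⬝ᵥ
        (((1 / (m : ℝ)) • (Sᵀ * S) - 1).mulVec (A.mulVec (x1 - xLS)))
      = (1 / (m : ℝ)) * (S.mulVec (A.mulVec (xLS - x0)) ⬝ᵥ S.mulVec (A.mulVec (x1 - xLS)))
        - A.mulVec (xLS - x0) ⬝ᵥ A.mulVec (x1 - xLS) := by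
    rw [sub_mulVec, one_mulVec, smul_mulVec, ← mulVec_mulVec, dotProduct_sub, dotProduct_smul,
      smul_eq_mul, dotProduct_mulVec _ Sᵀ, vecMul_transpose]
  rw [e4, sqNorm_eq_dot]
  generalize A.mulVec (x1 - xLS) = e at *
  generalize A.mulVec (xLS - x0) = w at *
  simp only [mulVec_neg, mulVec_add, dotProduct_neg, add_dotProduct, sub_dotProduct] at opt2 opt1'
  simp only [mul_neg, mul_add] at opt2
  linarith

theorem step_bound {n d m : ℕ} (C : Set (Fin d → ℝ))
    (A : Matrix (Fin n) (Fin d) ℝ) (S : Matrix (Fin m) (Fin n) ℝ)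
    (xLS x1 : Fin d → ℝ) (hmem : x1 ∈ C) (w : Fin n → ℝ) (hw : w ≠ 0)
    (hkey : (1 / (m : ℝ)) * sqNorm (S.mulVec (A.mulVec (x1 - xLS))) ≤
      - (w ⬝ᵥ (((1 / (m : ℝ)) • (Sᵀ * S) - 1).mulVec (A.mulVec (x1 - xLS)))))
    (hZ1 : 0 < Z1 S (Kcone A C xLS)) :
    l2norm (A.mulVec (x1 - xLS)) ≤
      Z2 S (Kcone A C xLS) ((l2norm w)⁻¹ • w) / Z1 S (Kcone A C xLS) * l2norm w := by
  have hZ2 := Z2_nn S (Kcone A C xLS) ((l2norm w)⁻¹ • w)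
  have hw0 : 0 ≤ l2norm w := Real.sqrt_nonneg _
  have hwp : 0 < l2norm w := lt_of_le_of_ne hw0 fun h => hw (l2norm_zero_imp w h.symm)
  have he0 : 0 ≤ l2norm (A.mulVec (x1 - xLS)) := Real.sqrt_nonneg _
  rcases he0.eq_or_lt with h | hep
  · rw [← h]; positivity
  set r := l2norm (A.mulVec (x1 - xLS)) with hr
  set v := r⁻¹ • A.mulVec (x1 - xLS) with hv
  have hvK : v ∈ Kcone A C xLS := ⟨r⁻¹, by positivity, x1, hmem, rfl⟩
  have hv1 : l2norm v = 1 := by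
    rw [hv, l2norm_smul' _ (by positivity), ← hr, inv_mul_cancel₀ hep.ne']
  have hev : A.mulVec (x1 - xLS) = r • v := by
    rw [hv, smul_smul, mul_inv_cancel₀ hep.ne', one_smul]
  have a1 := Z1_le S _ v hvK hv1
  have a2 := le_Z2 S _ ((l2norm w)⁻¹ • w) v hvK hv1
  have a3 := (neg_le_abs _).trans a2
  rw [smul_dotProduct, smul_eq_mul] at a3
  clear_value v
  rw [hev, mulVec_smul, mulVec_smul, dotProduct_smul, smul_eq_mul] at hkey
  have hsq : sqNorm (r • S.mulVec v) = r ^ 2 * sqNorm (S.mulVec v) := by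
    simp [sqNorm, mul_pow, Finset.mul_sum]
  rw [hsq] at hkey
  generalize w ⬝ᵥ (((1 / (m : ℝ)) • (Sᵀ * S) - 1).mulVec v) = q at *
  have b1 : r * ((1 / (m : ℝ)) * sqNorm (S.mulVec v)) ≤ -q := by
    refine le_of_mul_le_mul_left ?_ hep
    linarith
  have b2 : -q ≤ Z2 S (Kcone A C xLS) ((l2norm w)⁻¹ • w) * l2norm w := by
    rw [← div_le_iff₀ hwp]
    refine le_trans (le_of_eq ?_) a3
    field_simp
  rw [div_mul_eq_mul_div, le_div_iff₀ hZ1]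
  have b3 := mul_le_mul_of_nonneg_left a1 hep.le
  linarith

/-- product bound for the iterative Hessian sketch (Theorem 2, eq. (24)).
Here `S t` is the sketch matrix S^{t+1} used to produce the iterate `x (t+1)`. -/
theorem ihs_product_bound
    {n d m N : ℕ} (hn : 0 < n) (hm : 0 < m)
    (C : Set (Fin d → ℝ)) (hC : Convex ℝ C)
    (A : Matrix (Fin n) (Fin d) ℝ) (y : Fin n → ℝ)
    (S : ℕ → Matrix (Fin m) (Fin n) ℝ)
    (xLS : Fin d → ℝ) (hLSmem : xLS ∈ C)
    (hLSmin : ∀ x ∈ C,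
      (1 / (2 * (n : ℝ))) * sqNorm (A.mulVec xLS - y)
        ≤ (1 / (2 * (n : ℝ))) * sqNorm (A.mulVec x - y))
    (x : ℕ → Fin d → ℝ) (hx0 : x 0 = 0)
    (hstepmem : ∀ t < N, x (t + 1) ∈ C)
    (hstepmin : ∀ t < N, ∀ z ∈ C,
      (1 / (2 * (m : ℝ))) * sqNorm ((S t).mulVec (A.mulVec (x (t + 1) - x t)))
          - (Aᵀ.mulVec (y - A.mulVec (x t))) ⬝ᵥ x (t + 1)
        ≤ (1 / (2 * (m : ℝ))) * sqNorm ((S t).mulVec (A.mulVec (z - x t)))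
          - (Aᵀ.mulVec (y - A.mulVec (x t))) ⬝ᵥ z)
    (hAt : ∀ t < N, A.mulVec (xLS - x t) ≠ 0)
    (hZ1 : ∀ t < N, 0 < Z1 (S t) (Kcone A C xLS)) :
    predNorm A (x N - xLS) ≤
      (∏ t ∈ Finset.range N,
          Z2 (S t) (Kcone A C xLS)
              ((l2norm (A.mulVec (xLS - x t)))⁻¹ • A.mulVec (xLS - x t))
            / Z1 (S t) (Kcone A C xLS)) * predNorm A xLS := by
  have hstep : ∀ t < N, predNorm A (x (t + 1) - xLS) ≤
      Z2 (S t) (Kcone A C xLS)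
              ((l2norm (A.mulVec (xLS - x t)))⁻¹ • A.mulVec (xLS - x t))
            / Z1 (S t) (Kcone A C xLS) * predNorm A (x t - xLS) := by
    intro t ht
    have h := step_bound C A (S t) xLS (x (t + 1)) (hstepmem t ht) _ (hAt t ht)
      (key_ineq hn hm C hC A y (S t) xLS hLSmem hLSmin (x t) (x (t + 1)) (hstepmem t ht)
        (hstepmin t ht)) (hZ1 t ht)
    have e : l2norm (A.mulVec (x t - xLS)) = l2norm (A.mulVec (xLS - x t)) := by
      rw [← l2norm_neg', ← mulVec_neg]; congr 2; abel
    rw [predNorm, predNorm, e, ← mul_div_assoc]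
    exact div_le_div_of_nonneg_right h (Real.sqrt_nonneg _)
  have hind : ∀ k ≤ N, predNorm A (x k - xLS) ≤
      (∏ t ∈ Finset.range k,
          Z2 (S t) (Kcone A C xLS)
              ((l2norm (A.mulVec (xLS - x t)))⁻¹ • A.mulVec (xLS - x t))
            / Z1 (S t) (Kcone A C xLS)) * predNorm A xLS := by
    intro k
    induction k with
    | zero =>
      intro _
      simp [hx0, predNorm, mulVec_neg, l2norm_neg']
    | succ k ih =>
      intro hk
      rw [Finset.prod_range_succ]
      refine (hstep k hk).trans ?_
      refine (mul_le_mul_of_nonneg_left (ih (Nat.le_of_succ_le hk))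
        (div_nonneg (Z2_nn _ _ _) (hZ1 k hk).le)).trans (le_of_eq (by ring))
  exact hind N le_rfl
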